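/- arXiv:1611.04753 — 2 statements merged into one kernel-verified Lean document; each statement's English description precedes it below -/
import Mathlib

section
/- Let R be a commutative ring and let w : R → ℝ ∪ {+∞} be a semivaluation, i.e. w(0) = +∞, w(x+y) ≥ min(w(x), w(y)) and w(xy) ≥ w(x) + w(y) for all x, y ∈ R. Define the spectral semivaluation w^sp(x) := sup_{n ≥ 1} w(x^n)/n (supremum in ℝ ∪ {±∞}, noting the values w(x^n)/n never equal −∞). Then w^sp is a power-multiplicative semivaluation dominating w: w^sp(0) = +∞, w^sp(x+y) ≥ min(w^sp(x), w^sp(y)), w^sp(xy) ≥ w^sp(x) + w^sp(y), w^sp(x^n) = n·w^sp(x) for every n ≥ 1, and w^sp(x) ≥ w(x) for every x ∈ R. -/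
open Filter Topology

/-- The spectral semivaluation `w^sp(x) = sup_{n ≥ 1} w(xⁿ)/n` associated with a semivaluation
`w` with values in `ℝ ∪ {+∞}` (the supremum being taken in the extended reals). -/
noncomputable def Stmt12.spectral {R : Type*} [CommRing R] (w : R → EReal) (x : R) : EReal :=
  ⨆ n : ℕ+, w (x ^ (n : ℕ)) / (((n : ℕ) : ℝ) : EReal)

namespace Stmt12

theorem ereal_le_of_forall_coe_lt {a b : EReal} (h : ∀ c : ℝ, (c : EReal) < a → (c : EReal) ≤ b) :
    a ≤ b := by
  refine le_of_forall_lt fun d hd => ?_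
  obtain ⟨c, hdc, hca⟩ := EReal.lt_iff_exists_real_btwn.1 hd
  exact hdc.trans_le (h c hca)

theorem coe_le_div_natCast_iff {n : ℕ} (hn : 1 ≤ n) (c : ℝ) (v : EReal) :
    (c : EReal) ≤ v / ((n : ℝ) : EReal) ↔ ((n * c : ℝ) : EReal) ≤ v := by
  have hpos : (0 : EReal) < ((n : ℝ) : EReal) := by
    exact_mod_cast (Nat.cast_pos.2 hn : (0 : ℝ) < n)
  rw [EReal.le_div_iff_mul_le hpos (EReal.coe_ne_top _), ← EReal.coe_mul, mul_comm]

variable {R : Type*} [CommRing R] {w : R → EReal}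

theorem exists_le_of_lt_spectral {x : R} {c : ℝ} (h : (c : EReal) < spectral w x) :
    ∃ n : ℕ, 1 ≤ n ∧ ((n * c : ℝ) : EReal) ≤ w (x ^ n) := by
  obtain ⟨n, hn⟩ := lt_iSup_iff.1 h
  exact ⟨n, n.pos, (coe_le_div_natCast_iff n.pos _ _).1 hn.le⟩

theorem le_spectral {x : R} {c : ℝ} {n : ℕ} (hn : 1 ≤ n)
    (h : ((n * c : ℝ) : EReal) ≤ w (x ^ n)) : (c : EReal) ≤ spectral w x :=
  ((coe_le_div_natCast_iff hn _ _).2 h).trans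
    (le_iSup (fun n : ℕ+ => w (x ^ (n : ℕ)) / (((n : ℕ) : ℝ) : EReal)) ⟨n, hn⟩)

theorem self_le_spectral (x : R) : w x ≤ spectral w x :=
  ereal_le_of_forall_coe_lt fun c hc => le_spectral le_rfl (by simpa using hc.le)

theorem coe_add_le_map_mul (hmul : ∀ x y : R, w x + w y ≤ w (x * y)) {x y : R} {s t : ℝ}
    (hs : (s : EReal) ≤ w x) (ht : (t : EReal) ≤ w y) : ((s + t : ℝ) : EReal) ≤ w (x * y) := by
  rw [EReal.coe_add]
  exact (add_le_add hs ht).trans (hmul x y)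

theorem coe_mul_le_map_pow (hmul : ∀ x y : R, w x + w y ≤ w (x * y)) {x : R} {t : ℝ}
    (ht : (t : EReal) ≤ w x) {n : ℕ} (hn : 1 ≤ n) : ((n * t : ℝ) : EReal) ≤ w (x ^ n) := by
  induction n, hn using Nat.le_induction with
  | base => simpa using ht
  | succ n hn ih =>
    have := coe_add_le_map_mul hmul ih ht
    rw [pow_succ]
    convert this using 2
    push_cast
    ring

theorem coe_mul_le_map_pow_mul (hmul : ∀ x y : R, w x + w y ≤ w (x * y)) {x : R} {c : ℝ}
    {m n : ℕ} (hn : 1 ≤ n) (h : ((m * c : ℝ) : EReal) ≤ w (x ^ m)) :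
    (((m * n : ℕ) * c : ℝ) : EReal) ≤ w (x ^ (m * n)) := by
  have := coe_mul_le_map_pow hmul h hn
  rw [pow_mul]
  convert this using 2
  push_cast
  ring

/-- If some power of `x` has average value at least `c`, then all powers of `x` do, up to a
bounded error. -/
theorem exists_forall_coe_sub_le_map_pow (hbot : ∀ x : R, w x ≠ ⊥)
    (hmul : ∀ x y : R, w x + w y ≤ w (x * y)) {x : R} {c : ℝ} {n : ℕ} (hn : 1 ≤ n)
    (h : ((n * c : ℝ) : EReal) ≤ w (x ^ n)) :
    ∃ C : ℝ, ∀ i : ℕ, ((i * c - C : ℝ) : EReal) ≤ w (x ^ i) := by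
  have hreal : ∀ r : ℕ, ∃ f : ℝ, (f : EReal) ≤ w (x ^ r) := fun r => by
    obtain ⟨f, -, hf⟩ := EReal.lt_iff_exists_real_btwn.1 (bot_lt_iff_ne_bot.2 (hbot (x ^ r)))
    exact ⟨f, hf.le⟩
  choose f hf using hreal
  refine ⟨∑ r ∈ Finset.range n, |r * c - f r|, fun i => ?_⟩
  induction i using Nat.strong_induction_on with
  | _ i ih =>
    rcases lt_or_ge i n with hi | hi
    · refine le_trans (EReal.coe_le_coe_iff.2 ?_) (hf i)
      have h₁ := Finset.single_le_sum (f := fun r : ℕ => |r * c - f r|)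
        (fun r _ => abs_nonneg _) (Finset.mem_range.2 hi)
      have h₂ := le_abs_self (i * c - f i)
      linarith
    · have := coe_add_le_map_mul hmul h (ih (i - n) (by omega))
      rw [← pow_add, Nat.add_sub_cancel' hi] at this
      convert this using 2
      rw [Nat.cast_sub hi]
      ring

theorem le_map_nsmul (h0 : w 0 = ⊤) (hadd : ∀ x y : R, min (w x) (w y) ≤ w (x + y))
    {a : EReal} {x : R} (hx : a ≤ w x) (n : ℕ) : a ≤ w (n • x) := by
  induction n with
  | zero => simp [h0]
  | succ n ih =>
    rw [succ_nsmul]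
    exact (le_min ih hx).trans (hadd _ _)

theorem le_map_sum (h0 : w 0 = ⊤) (hadd : ∀ x y : R, min (w x) (w y) ≤ w (x + y))
    {ι : Type*} {a : EReal} (s : Finset ι) (f : ι → R) (hf : ∀ i ∈ s, a ≤ w (f i)) :
    a ≤ w (∑ i ∈ s, f i) :=
  Finset.sum_induction f (fun x => a ≤ w x)
    (fun _ _ hx hy => (le_min hx hy).trans (hadd _ _)) (by simp [h0]) hf

theorem spectral_zero (h0 : w 0 = ⊤) : spectral w 0 = ⊤ :=
  top_le_iff.1 (h0 ▸ self_le_spectral (w := w) 0)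

theorem min_spectral_le_spectral_add (hbot : ∀ x : R, w x ≠ ⊥) (h0 : w 0 = ⊤)
    (hadd : ∀ x y : R, min (w x) (w y) ≤ w (x + y))
    (hmul : ∀ x y : R, w x + w y ≤ w (x * y)) (x y : R) :
    min (spectral w x) (spectral w y) ≤ spectral w (x + y) := by
  refine ereal_le_of_forall_coe_lt fun c hc => ?_
  obtain ⟨d, hcd, hd⟩ := EReal.lt_iff_exists_real_btwn.1 hc
  have hcd : c < d := EReal.coe_lt_coe_iff.1 hcd
  obtain ⟨m, hm, hxm⟩ := exists_le_of_lt_spectral (lt_min_iff.1 hd).1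
  obtain ⟨n, hn, hyn⟩ := exists_le_of_lt_spectral (lt_min_iff.1 hd).2
  obtain ⟨A, hA⟩ := exists_forall_coe_sub_le_map_pow hbot hmul hm hxm
  obtain ⟨B, hB⟩ := exists_forall_coe_sub_le_map_pow hbot hmul hn hyn
  obtain ⟨k, hk⟩ := exists_nat_ge ((A + B) / (d - c))
  have hk : A + B ≤ (k + 1 : ℕ) * (d - c) := by
    rw [div_le_iff₀ (sub_pos.2 hcd)] at hk
    push_cast
    linarith
  refine le_spectral (n := k + 1) (by omega) ?_
  rw [add_pow]
  refine le_map_sum h0 hadd _ _ fun i hi => ?_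
  rw [← nsmul_eq_mul']
  refine le_map_nsmul h0 hadd (le_trans (EReal.coe_le_coe_iff.2 ?_)
    (coe_add_le_map_mul hmul (hA i) (hB (k + 1 - i)))) _
  rw [Nat.cast_sub (Finset.mem_range_succ_iff.1 hi)]
  linarith

theorem spectral_add_le_spectral_mul (hmul : ∀ x y : R, w x + w y ≤ w (x * y)) (x y : R) :
    spectral w x + spectral w y ≤ spectral w (x * y) := by
  refine EReal.add_le_of_forall_lt fun a ha b hb => ?_
  obtain ⟨s, has, hs⟩ := EReal.lt_iff_exists_real_btwn.1 ha
  obtain ⟨t, hbt, ht⟩ := EReal.lt_iff_exists_real_btwn.1 hb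
  refine (add_le_add has.le hbt.le).trans ?_
  obtain ⟨m, hm, hxm⟩ := exists_le_of_lt_spectral hs
  obtain ⟨n, hn, hyn⟩ := exists_le_of_lt_spectral ht
  rw [← EReal.coe_add]
  refine le_spectral (n := m * n) (Nat.mul_pos hm hn) ?_
  have hy := coe_mul_le_map_pow_mul hmul hm hyn
  rw [mul_comm n m] at hy
  rw [mul_pow, mul_add]
  exact coe_add_le_map_mul hmul (coe_mul_le_map_pow_mul hmul hn hxm) hy

theorem spectral_pow (hmul : ∀ x y : R, w x + w y ≤ w (x * y)) (x : R) {n : ℕ} (hn : 1 ≤ n) :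
    spectral w (x ^ n) = ((n : ℝ) : EReal) * spectral w x := by
  have hn₀ : (0 : ℝ) < n := Nat.cast_pos.2 hn
  have hn₁ : (0 : EReal) < ((n : ℝ) : EReal) := EReal.coe_pos.2 hn₀
  apply le_antisymm
  · refine ereal_le_of_forall_coe_lt fun c hc => ?_
    obtain ⟨m, hm, h⟩ := exists_le_of_lt_spectral hc
    have hle : ((c / n : ℝ) : EReal) ≤ spectral w x := by
      refine le_spectral (n := n * m) (Nat.mul_pos hn hm) ?_
      rw [pow_mul]
      convert h using 2
      push_cast
      field_simp
    calc (c : EReal) = ((n : ℝ) : EReal) * ((c / n : ℝ) : EReal) := by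
          rw [← EReal.coe_mul, mul_div_cancel₀ _ hn₀.ne']
      _ ≤ _ := mul_le_mul_of_nonneg_left hle hn₁.le
  · refine ereal_le_of_forall_coe_lt fun c hc => ?_
    have hlt : ((c / n : ℝ) : EReal) < spectral w x := by
      rw [EReal.coe_div]
      exact (EReal.div_lt_iff hn₁ (EReal.coe_ne_top _)).2 (by rwa [mul_comm])
    obtain ⟨m, hm, h⟩ := exists_le_of_lt_spectral hlt
    refine le_spectral hm ?_
    rw [← pow_mul, mul_comm n m]
    convert coe_mul_le_map_pow_mul hmul hn h using 2
    push_cast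
    field_simp

end Stmt12

/-- Let `w` be a semivaluation on a commutative ring `R` with values in
`ℝ ∪ {+∞}` (i.e. never `−∞`).  Then its spectral semivaluation `w^sp` is a power-multiplicative
semivaluation dominating `w`. -/
theorem stmt_12 {R : Type*} [CommRing R] (w : R → EReal)
    (hbot : ∀ x : R, w x ≠ ⊥) (h0 : w 0 = ⊤)
    (hadd : ∀ x y : R, min (w x) (w y) ≤ w (x + y))
    (hmul : ∀ x y : R, w x + w y ≤ w (x * y)) :
    Stmt12.spectral w 0 = ⊤ ∧
      (∀ x y : R, min (Stmt12.spectral w x) (Stmt12.spectral w y) ≤ Stmt12.spectral w (x + y)) ∧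
      (∀ x y : R, Stmt12.spectral w x + Stmt12.spectral w y ≤ Stmt12.spectral w (x * y)) ∧
      (∀ (x : R) (n : ℕ), 1 ≤ n →
        Stmt12.spectral w (x ^ n) = (((n : ℝ) : EReal)) * Stmt12.spectral w x) ∧
      (∀ x : R, w x ≤ Stmt12.spectral w x) := by
  exact ⟨Stmt12.spectral_zero h0, Stmt12.min_spectral_le_spectral_add hbot h0 hadd hmul,
    Stmt12.spectral_add_le_spectral_mul hmul, fun x _ hn => Stmt12.spectral_pow hmul x hn,
    Stmt12.self_le_spectral⟩
end

section
/- Let k be a commutative ring, let R₁ and R₂ be commutative k-algebras, and let w₁ and w₂ be semivaluations on R₁ and R₂ respectively with values in ℝ ∪ {+∞}. For y in the algebraic tensor product R₁ ⊗_k R₂, define w(y) as the supremum, over all finite representations y = Σ_{j=1}^{M} y_{j,1} ⊗ y_{j,2} with y_{j,i} ∈ R_i, of min_{j=1,…,M} (w₁(y_{j,1}) + w₂(y_{j,2})) (with the convention that the minimum over the empty representation of 0 is +∞). Then w is a semivaluation on R₁ ⊗_k R₂: w(0) = +∞, w(y + y′) ≥ min(w(y), w(y′)), and w(y·y′) ≥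 w(y) + w(y′) for all y, y′ ∈ R₁ ⊗_k R₂. -/
open Filter Topology TensorProduct

/-- The product semivaluation on `R₁ ⊗[k] R₂`: `w(y)` is the supremum, over all finite
representations `y = Σ_j y_{j,1} ⊗ y_{j,2}`, of `min_j (w₁(y_{j,1}) + w₂(y_{j,2}))`, the
minimum over an empty representation (of `0`) being `+∞` (the empty infimum in the extended
reals). -/
noncomputable def Stmt15.prodVal {k R₁ R₂ : Type*} [CommRing k] [CommRing R₁] [CommRing R₂]
    [Algebra k R₁] [Algebra k R₂] (w₁ : R₁ → EReal) (w₂ : R₂ → EReal)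
    (y : R₁ ⊗[k] R₂) : EReal :=
  ⨆ r : {r : Σ m : ℕ, (Fin m → R₁) × (Fin m → R₂) //
      y = ∑ j : Fin r.1, r.2.1 j ⊗ₜ[k] r.2.2 j},
    ⨅ j : Fin r.1.1, (w₁ (r.1.2.1 j) + w₂ (r.1.2.2 j))

section ProdVal

variable {k R₁ R₂ : Type*} [CommRing k] [CommRing R₁] [CommRing R₂] [Algebra k R₁] [Algebra k R₂]
  {w₁ : R₁ → EReal} {w₂ : R₂ → EReal}

theorem Stmt15.le_prodVal_sum {ι : Type*} [Fintype ι] (a : ι → R₁) (b : ι → R₂) {c : EReal}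
    (h : ∀ i, c ≤ w₁ (a i) + w₂ (b i)) : c ≤ prodVal w₁ w₂ (∑ i, a i ⊗ₜ[k] b i) := by
  let e := (Fintype.equivFin ι).symm
  exact le_iSup_of_le ⟨⟨Fintype.card ι, a ∘ e, b ∘ e⟩,
    (Equiv.sum_comp e fun i => a i ⊗ₜ[k] b i).symm⟩ (le_iInf fun j => h (e j))

theorem Stmt15.exists_rep_of_lt_prodVal {y : R₁ ⊗[k] R₂} {c : EReal} (h : c < prodVal w₁ w₂ y) :
    ∃ (m : ℕ) (a : Fin m → R₁) (b : Fin m → R₂),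
      y = ∑ j, a j ⊗ₜ[k] b j ∧ ∀ j, c ≤ w₁ (a j) + w₂ (b j) := by
  obtain ⟨⟨⟨m, a, b⟩, hy⟩, hc⟩ := lt_iSup_iff.1 h
  exact ⟨m, a, b, hy, fun j => hc.le.trans (iInf_le _ j)⟩

theorem Stmt15.prodVal_zero : prodVal w₁ w₂ (0 : R₁ ⊗[k] R₂) = ⊤ := by
  have h := le_prodVal_sum (k := k) (w₁ := w₁) (w₂ := w₂) (c := ⊤) (Empty.elim ·) (Empty.elim ·)
    fun i => i.elim
  rwa [Finset.univ_eq_empty, Finset.sum_empty, top_le_iff] at h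

theorem Stmt15.min_le_prodVal_add (y y' : R₁ ⊗[k] R₂) :
    min (prodVal w₁ w₂ y) (prodVal w₁ w₂ y') ≤ prodVal w₁ w₂ (y + y') := by
  refine le_of_forall_lt_imp_le_of_dense fun c hc => ?_
  obtain ⟨m, a, b, rfl, h⟩ := exists_rep_of_lt_prodVal (lt_min_iff.1 hc).1
  obtain ⟨n, a', b', rfl, h'⟩ := exists_rep_of_lt_prodVal (lt_min_iff.1 hc).2
  simpa using le_prodVal_sum (k := k) (Sum.elim a a') (Sum.elim b b') (Sum.rec h h')

theorem Stmt15.add_le_prodVal_mul (h₁ : ∀ x y : R₁, w₁ x + w₁ y ≤ w₁ (x * y))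
    (h₂ : ∀ x y : R₂, w₂ x + w₂ y ≤ w₂ (x * y)) (y y' : R₁ ⊗[k] R₂) :
    prodVal w₁ w₂ y + prodVal w₁ w₂ y' ≤ prodVal w₁ w₂ (y * y') := by
  refine EReal.add_le_of_forall_lt fun c hc c' hc' => ?_
  obtain ⟨m, a, b, rfl, h⟩ := exists_rep_of_lt_prodVal hc
  obtain ⟨n, a', b', rfl, h'⟩ := exists_rep_of_lt_prodVal hc'
  simp only [Finset.sum_mul_sum, Algebra.TensorProduct.tmul_mul_tmul, ← Fintype.sum_prod_type']
  refine le_prodVal_sum _ _ fun i => ?_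
  calc c + c' ≤ (w₁ (a i.1) + w₂ (b i.1)) + (w₁ (a' i.2) + w₂ (b' i.2)) :=
        add_le_add (h _) (h' _)
    _ = (w₁ (a i.1) + w₁ (a' i.2)) + (w₂ (b i.1) + w₂ (b' i.2)) := add_add_add_comm ..
    _ ≤ _ := add_le_add (h₁ _ _) (h₂ _ _)

end ProdVal

/-- If `w₁` and `w₂` are semivaluations (values in `ℝ ∪ {+∞}`) on the
commutative `k`-algebras `R₁` and `R₂`, then the product semivaluation `w` on `R₁ ⊗[k] R₂` is a
semivaluation: `w(0) = +∞`, `w(y + y') ≥ min(w y, w y')` and `w(y·y') ≥ w y + w y'`. -/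
theorem stmt_15 {k R₁ R₂ : Type*} [CommRing k] [CommRing R₁] [CommRing R₂]
    [Algebra k R₁] [Algebra k R₂] (w₁ : R₁ → EReal) (w₂ : R₂ → EReal)
    (h₁bot : ∀ x : R₁, w₁ x ≠ ⊥) (h₁0 : w₁ 0 = ⊤)
    (h₁add : ∀ x y : R₁, min (w₁ x) (w₁ y) ≤ w₁ (x + y))
    (h₁mul : ∀ x y : R₁, w₁ x + w₁ y ≤ w₁ (x * y))
    (h₂bot : ∀ x : R₂, w₂ x ≠ ⊥) (h₂0 : w₂ 0 = ⊤)
    (h₂add : ∀ x y : R₂, min (w₂ x) (w₂ y) ≤ w₂ (x + y))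
    (h₂mul : ∀ x y : R₂, w₂ x + w₂ y ≤ w₂ (x * y)) :
    Stmt15.prodVal w₁ w₂ (0 : R₁ ⊗[k] R₂) = ⊤ ∧
      (∀ y y' : R₁ ⊗[k] R₂,
        min (Stmt15.prodVal w₁ w₂ y) (Stmt15.prodVal w₁ w₂ y') ≤ Stmt15.prodVal w₁ w₂ (y + y')) ∧
      (∀ y y' : R₁ ⊗[k] R₂,
        Stmt15.prodVal w₁ w₂ y + Stmt15.prodVal w₁ w₂ y' ≤ Stmt15.prodVal w₁ w₂ (y * y')) := by
  exact ⟨Stmt15.prodVal_zero, Stmt15.min_le_prodVal_add, Stmt15.add_le_prodVal_mul h₁mul h₂mul⟩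
end
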